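/- Let l and n be positive integers, Δ = 1/l, t_m = mΔ for m ∈ ℤ, let q ≥ 1 be a real number, let μ be a Borel probability measure on (−∞,0], and let x₀, …, x_{n−1} ∈ ℝⁿ. Then Σ_{j=1}^{n−1} Σ_{m=−j}^{−1} ∫_{(t_m, t_{m+1}]} | ((t_{m+1} − u)/Δ) x_{j+m} + ((u − t_m)/Δ) x_{j+m+1} |^q μ(du) ≤ μ((−t_{n−1}, 0]) · Σ_{j=0}^{n−1} |x_j|^q. -/

import Mathlib

open MeasureTheory Filter Set

noncomputable section

/-- Euclidean norm on `Fin n → ℝ`. -/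
def vnorm {n : ℕ} (x : Fin n → ℝ) : ℝ := Real.sqrt (∑ i, x i ^ 2)

theorem vnorm_eq_norm_toLp {d : ℕ} (x : Fin d → ℝ) : vnorm x = ‖WithLp.toLp 2 x‖ := by
  simp [vnorm, EuclideanSpace.norm_eq]

theorem vnorm_nonneg {d : ℕ} (x : Fin d → ℝ) : 0 ≤ vnorm x :=
  Real.sqrt_nonneg _

theorem vnorm_convex_combination_rpow_le {d : ℕ} {q : ℝ} (hq : 1 ≤ q) (x y : Fin d → ℝ)
    {a b : ℝ} (ha : 0 ≤ a) (hb : 0 ≤ b) (hab : a + b = 1) :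
    vnorm (a • x + b • y) ^ q ≤ a * vnorm x ^ q + b * vnorm y ^ q := by
  have hle : vnorm (a • x + b • y) ≤ a * vnorm x + b * vnorm y := by
    simp only [vnorm_eq_norm_toLp, WithLp.toLp_add, WithLp.toLp_smul]
    refine (norm_add_le _ _).trans_eq ?_
    rw [norm_smul, norm_smul, Real.norm_of_nonneg ha, Real.norm_of_nonneg hb]
  calc vnorm (a • x + b • y) ^ q ≤ (a * vnorm x + b * vnorm y) ^ q :=
        Real.rpow_le_rpow (vnorm_nonneg _) hle (by linarith)
    _ ≤ a * vnorm x ^ q + b * vnorm y ^ q := by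
        simpa using (convexOn_rpow hq).2 (mem_Ici.2 (vnorm_nonneg x))
          (mem_Ici.2 (vnorm_nonneg y)) ha hb hab

theorem sum_Ico_sub_le_sum_range {f : ℤ → ℝ} (hf : ∀ i, 0 ≤ f i) {k p : ℕ} (hkp : k ≤ p)
    (n : ℕ) : ∑ j ∈ Finset.Ico p n, f ((j : ℤ) - k) ≤ ∑ j ∈ Finset.range n, f j := by
  calc ∑ j ∈ Finset.Ico p n, f ((j : ℤ) - k) ≤ ∑ j ∈ Finset.Ico k n, f ((j : ℤ) - k) :=
        Finset.sum_le_sum_of_subset_of_nonneg (Finset.Ico_subset_Ico_left hkp)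
          fun _ _ _ => hf _
    _ = ∑ j ∈ Finset.range (n - k), f j := by
        rw [Finset.sum_Ico_eq_sum_range]
        exact Finset.sum_congr rfl fun j _ => by push_cast; congr 1; ring
    _ ≤ ∑ j ∈ Finset.range n, f j :=
        Finset.sum_le_sum_of_subset_of_nonneg (Finset.range_mono (Nat.sub_le n k))
          fun _ _ _ => hf _

theorem sum_Ico_neg_zero_eq_sum_range (f : ℤ → ℝ) (j : ℕ) :
    ∑ m ∈ Finset.Ico (-(j : ℤ)) 0, f m = ∑ p ∈ Finset.range j, f (-((p : ℤ) + 1)) := by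
  refine Finset.sum_nbij' (fun m => (-m - 1).toNat) (fun p => -((p : ℤ) + 1)) ?_ ?_ ?_ ?_ ?_
  · intro m hm
    simp only [Finset.mem_Ico, Finset.mem_range] at hm ⊢
    omega
  · intro p hp
    simp only [Finset.mem_Ico, Finset.mem_range] at hp ⊢
    omega
  · intro m hm
    simp only [Finset.mem_Ico] at hm ⊢
    omega
  · intro p _
    omega
  · intro m hm
    simp only [Finset.mem_Ico] at hm
    congr 1
    omega

theorem sum_measureReal_Ioc_neg (μ : Measure ℝ) [IsFiniteMeasure μ] {Δ : ℝ} (hΔ : 0 ≤ Δ)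
    (N : ℕ) :
    ∑ p ∈ Finset.range N, μ.real (Ioc (-((p : ℝ) + 1) * Δ) ((-((p : ℝ) + 1) + 1) * Δ))
      = μ.real (Ioc (-((N : ℝ) * Δ)) 0) := by
  induction N with
  | zero => simp
  | succ N ih =>
    have hN : 0 ≤ (N : ℝ) * Δ := by positivity
    have hunion : Ioc (-(((N + 1 : ℕ) : ℝ) * Δ)) 0
        = Ioc (-(((N + 1 : ℕ) : ℝ) * Δ)) (-((N : ℝ) * Δ)) ∪ Ioc (-((N : ℝ) * Δ)) 0 := by
      refine (Ioc_union_Ioc_eq_Ioc ?_ ?_).symm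
      · push_cast
        linarith
      · linarith
    rw [Finset.sum_range_succ, ih, hunion,
      measureReal_union (Ioc_disjoint_Ioc_of_le le_rfl) measurableSet_Ioc, add_comm]
    congr 3
    · push_cast
      ring
    · ring

theorem setIntegral_affine_interpolation_rpow_le {d : ℕ} {q : ℝ} (hq : 1 ≤ q)
    (μ : Measure ℝ) [IsFiniteMeasure μ] (x y : Fin d → ℝ) {s t Δ : ℝ} (hΔ : 0 < Δ)
    (hst : t - s = Δ) :
    ∫ u in Ioc s t, vnorm (((t - u) / Δ) • x + ((u - s) / Δ) • y) ^ q ∂μ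
      ≤ (∫ u in Ioc s t, (t - u) / Δ ∂μ) * vnorm x ^ q
        + (∫ u in Ioc s t, (u - s) / Δ ∂μ) * vnorm y ^ q := by
  have hx : IntegrableOn (fun u => (t - u) / Δ * vnorm x ^ q) (Ioc s t) μ :=
    Continuous.integrableOn_Ioc (by fun_prop)
  have hy : IntegrableOn (fun u => (u - s) / Δ * vnorm y ^ q) (Ioc s t) μ :=
    Continuous.integrableOn_Ioc (by fun_prop)
  rw [← integral_mul_const, ← integral_mul_const, ← integral_add hx hy]
  refine integral_mono_of_nonneg
    (Eventually.of_forall fun u => Real.rpow_nonneg (vnorm_nonneg _) q) (hx.add hy) ?_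
  filter_upwards [ae_restrict_mem measurableSet_Ioc] with u hu
  refine vnorm_convex_combination_rpow_le hq x y
    (div_nonneg (sub_nonneg.2 hu.2) hΔ.le) (div_nonneg (sub_nonneg.2 hu.1.le) hΔ.le) ?_
  rw [← add_div, div_eq_one_iff_eq hΔ.ne']
  linarith

theorem setIntegral_affine_weights_add (μ : Measure ℝ) [IsFiniteMeasure μ] {s t Δ : ℝ}
    (hΔ : 0 < Δ) (hst : t - s = Δ) :
    (∫ u in Ioc s t, (t - u) / Δ ∂μ) + (∫ u in Ioc s t, (u - s) / Δ ∂μ)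
      = μ.real (Ioc s t) := by
  rw [← integral_add (Continuous.integrableOn_Ioc (by fun_prop))
    (Continuous.integrableOn_Ioc (by fun_prop))]
  have h : ∀ u : ℝ, (t - u) / Δ + (u - s) / Δ = 1 := fun u => by
    rw [← add_div, div_eq_one_iff_eq hΔ.ne']
    linarith
  simp [h]

theorem sum_setIntegral_affine_interpolation_le {d : ℕ} {q : ℝ} (hq : 1 ≤ q)
    (μ : Measure ℝ) [IsFiniteMeasure μ] (x : ℤ → Fin d → ℝ) {s t Δ : ℝ} (hΔ : 0 < Δ)
    (hst : t - s = Δ) (p n : ℕ) :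
    ∑ j ∈ Finset.Ico (p + 1) n,
        ∫ u in Ioc s t, vnorm (((t - u) / Δ) • x ((j : ℤ) + -((p : ℤ) + 1))
          + ((u - s) / Δ) • x ((j : ℤ) + -((p : ℤ) + 1) + 1)) ^ q ∂μ
      ≤ μ.real (Ioc s t) * ∑ j ∈ Finset.range n, vnorm (x j) ^ q := by
  have hnonneg : ∀ i, 0 ≤ vnorm (x i) ^ q := fun i => Real.rpow_nonneg (vnorm_nonneg _) q
  have hleft := sum_Ico_sub_le_sum_range hnonneg (le_refl (p + 1)) n
  have hright := sum_Ico_sub_le_sum_range hnonneg (Nat.le_succ p) n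
  refine (Finset.sum_le_sum fun j _ =>
    setIntegral_affine_interpolation_rpow_le hq μ _ _ hΔ hst).trans ?_
  rw [Finset.sum_add_distrib, ← Finset.mul_sum, ← Finset.mul_sum,
    ← setIntegral_affine_weights_add μ hΔ hst, add_mul]
  refine add_le_add (mul_le_mul_of_nonneg_left ?_ ?_) (mul_le_mul_of_nonneg_left ?_ ?_)
  · simpa only [Nat.cast_add, Nat.cast_one, sub_eq_add_neg] using hleft
  · exact setIntegral_nonneg measurableSet_Ioc fun u hu =>
      div_nonneg (sub_nonneg.2 hu.2) hΔ.le
  · refine le_of_eq_of_le (Finset.sum_congr rfl fun j _ => ?_) hright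
    rw [show (j : ℤ) + -((p : ℤ) + 1) + 1 = j - p by ring]
  · exact setIntegral_nonneg measurableSet_Ioc fun u hu =>
      div_nonneg (sub_nonneg.2 hu.1.le) hΔ.le

/-- The interpolation summation bound (display (3.18) of the paper): for a grid
`t_m = m Δ` with `Δ = 1/l`, a probability measure `μ` on `(-∞,0]`, `q ≥ 1` and
vectors `x₀, …, x_{n-1}`,
`Σ_{j=1}^{n-1} Σ_{m=-j}^{-1} ∫_{(t_m,t_{m+1}]} |((t_{m+1}-u)/Δ) x_{j+m} + ((u-t_m)/Δ) x_{j+m+1}|^q μ(du)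
  ≤ μ((-t_{n-1},0]) Σ_{j=0}^{n-1} |x_j|^q`. -/
theorem interpolation_sum_bound
    (l n nd : ℕ) (hl : 0 < l) (hn : 0 < n)
    (Δ : ℝ) (hΔ : Δ = 1 / (l : ℝ))
    (q : ℝ) (hq : 1 ≤ q)
    (μ : Measure ℝ) [IsProbabilityMeasure μ] (hsupp : μ (Set.Ioi 0) = 0)
    (x : ℤ → Fin nd → ℝ) :
    (∑ j ∈ Finset.Ico 1 n, ∑ m ∈ Finset.Ico (-(j : ℤ)) 0,
        ∫ u in Set.Ioc ((m : ℝ) * Δ) (((m : ℝ) + 1) * Δ),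
          (vnorm (((((m : ℝ) + 1) * Δ - u) / Δ) • x ((j : ℤ) + m)
            + ((u - (m : ℝ) * Δ) / Δ) • x ((j : ℤ) + m + 1))) ^ q ∂μ)
      ≤ (μ (Set.Ioc (-(((n : ℝ) - 1) * Δ)) 0)).toReal
          * ∑ j ∈ Finset.range n, (vnorm (x (j : ℤ))) ^ q := by
  have hΔpos : 0 < Δ := by
    rw [hΔ]
    positivity
  obtain ⟨N, rfl⟩ : ∃ N, n = N + 1 := ⟨n - 1, by omega⟩
  simp_rw [sum_Ico_neg_zero_eq_sum_range]
  rw [Finset.sum_comm' (t' := Finset.range N) (s' := fun p => Finset.Ico (p + 1) (N + 1))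
    (fun j p => by simp only [Finset.mem_Ico, Finset.mem_range]; omega)]
  push_cast
  rw [add_sub_cancel_right, ← measureReal_def, ← sum_measureReal_Ioc_neg μ hΔpos.le N,
    Finset.sum_mul]
  exact Finset.sum_le_sum fun p _ =>
    sum_setIntegral_affine_interpolation_le hq μ x hΔpos (by ring) p (N + 1)
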